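/- Let a > 0 and let g be holomorphic on the strip S_a = {τ ∈ ℂ : 0 < Im τ < a} satisfying the slow-growth condition with constants (C, N, M). Let f : ℝ → ℂ be a Schwartz function and define L(y) = ∫_ℝ g(x+iy) f(x) dx for y ∈ (0,a). Then L is infinitely differentiable on (0,a) and for every nonnegative integer j, L^{(j)}(y) = (-i)^j ∫_ℝ g(x+iy) f^{(j)}(x) dx for all y ∈ (0,a). -/

import Mathlib

open MeasureTheory Filter Complex

/-- A Schwartz function times the majorant of a function of polynomial growth is integrable. -/
lemma SchwartzMap.integrable_poly_mul_norm (f : SchwartzMap ℝ ℂ) (A B : ℝ) (N : ℕ) :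
    Integrable (fun x : ℝ ↦ (A + B * |x| ^ N) * ‖f x‖) := by
  have h := ((f.integrable (μ := volume)).norm.const_mul A).add
    ((f.integrable_pow_mul volume N).const_mul B)
  refine h.congr (Eventually.of_forall fun x ↦ ?_)
  simp only [Pi.add_apply, Real.norm_eq_abs]
  ring

/-- A continuous function of polynomial growth times a Schwartz function is integrable. -/
lemma SchwartzMap.integrable_mul_of_poly_growth (f : SchwartzMap ℝ ℂ) {u : ℝ → ℂ}
    (hu : Continuous u) {A B : ℝ} {N : ℕ} (hbound : ∀ x, ‖u x‖ ≤ A + B * |x| ^ N) :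
    Integrable (fun x ↦ u x * f x) := by
  refine (f.integrable_poly_mul_norm A B N).mono'
    (hu.mul f.continuous).aestronglyMeasurable (Eventually.of_forall fun x ↦ ?_)
  rw [norm_mul]
  gcongr
  exact hbound x

lemma isOpen_horizontal_strip (a : ℝ) : IsOpen {τ : ℂ | 0 < τ.im ∧ τ.im < a} :=
  (isOpen_lt continuous_const continuous_im).inter (isOpen_lt continuous_im continuous_const)

/-- Cauchy's estimate: the derivative of a holomorphic function of slow growth on a strip is of
polynomial growth, locally uniformly in the imaginary part. -/
lemma exists_poly_bound_deriv_of_slow_growth {a : ℝ} {g : ℂ → ℂ}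
    (hg : DifferentiableOn ℂ g {τ : ℂ | 0 < τ.im ∧ τ.im < a})
    {C : ℝ} (hC : 0 < C) {N M : ℕ}
    (hbound : ∀ x y : ℝ, 0 < y → y < a →
      ‖g (↑x + ↑y * Complex.I)‖ ≤ C * (1 + |x| ^ N) / y ^ M)
    {y₀ : ℝ} (hy₀ : y₀ ∈ Set.Ioo 0 a) :
    ∃ r > 0, ∃ A B : ℝ, ∀ y ∈ Metric.ball y₀ r, y ∈ Set.Ioo 0 a ∧
      ∀ x : ℝ, ‖deriv g (↑x + ↑y * Complex.I)‖ ≤ A + B * |x| ^ N := by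
  obtain ⟨h0, h1⟩ := hy₀
  obtain ⟨r, hr, hr0, hr1⟩ : ∃ r > 0, 3 * r ≤ y₀ ∧ 3 * r ≤ a - y₀ := by
    refine ⟨min y₀ (a - y₀) / 3, ?_, ?_, ?_⟩
    · have : 0 < min y₀ (a - y₀) := lt_min h0 (by linarith)
      positivity
    · linarith [min_le_left y₀ (a - y₀)]
    · linarith [min_le_right y₀ (a - y₀)]
  refine ⟨r, hr, C * (1 + 2 ^ (N - 1) * r ^ N) / r ^ M / r, C * 2 ^ (N - 1) / r ^ M / r,
    fun y hy ↦ ?_⟩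
  rw [Metric.mem_ball, Real.dist_eq, abs_lt] at hy
  refine ⟨⟨by linarith, by linarith⟩, fun x ↦ ?_⟩
  have hre_im : ∀ z ∈ Metric.closedBall (↑x + ↑y * Complex.I) r,
      |z.re| ≤ |x| + r ∧ r ≤ z.im ∧ z.im < a := by
    intro z hz
    rw [Metric.mem_closedBall, Complex.dist_eq] at hz
    have hre := (abs_re_le_norm _).trans hz
    have him := (abs_im_le_norm _).trans hz
    simp only [sub_re, add_re, ofReal_re, mul_re, I_re, mul_zero, ofReal_im, I_im, mul_one,
      sub_self, add_zero, sub_im, add_im, mul_im, zero_add] at hre him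
    rw [abs_le] at him
    have := abs_sub_abs_le_abs_sub z.re x
    exact ⟨by linarith, by linarith, by linarith⟩
  have hsphere : ∀ z ∈ Metric.sphere (↑x + ↑y * Complex.I) r,
      ‖g z‖ ≤ C * (1 + 2 ^ (N - 1) * (|x| ^ N + r ^ N)) / r ^ M := by
    intro z hz
    obtain ⟨hre, him, him'⟩ := hre_im z (Metric.sphere_subset_closedBall hz)
    have h := hbound z.re z.im (by linarith) him'
    rw [re_add_im] at h
    refine h.trans ?_
    gcongr
    exact (pow_le_pow_left₀ (abs_nonneg _) hre N).trans (add_pow_le (abs_nonneg x) hr.le N)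
  have hd : DiffContOnCl ℂ g (Metric.ball (↑x + ↑y * Complex.I) r) := by
    refine DifferentiableOn.diffContOnCl_ball (U := {τ : ℂ | 0 < τ.im ∧ τ.im < a}) hg ?_
    intro z hz
    obtain ⟨-, him, him'⟩ := hre_im z hz
    exact ⟨by linarith, him'⟩
  refine (norm_deriv_le_of_forall_mem_sphere_norm_le hr hd hsphere).trans_eq ?_
  field_simp
  ring

/-- Differentiating the smeared function in `y` amounts to differentiating the test function. -/
lemma hasDerivAt_integral_mul_schwartz {a : ℝ} {g : ℂ → ℂ}
    (hg : DifferentiableOn ℂ g {τ : ℂ | 0 < τ.im ∧ τ.im < a})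
    {C : ℝ} (hC : 0 < C) {N M : ℕ}
    (hbound : ∀ x y : ℝ, 0 < y → y < a →
      ‖g (↑x + ↑y * Complex.I)‖ ≤ C * (1 + |x| ^ N) / y ^ M)
    (f : SchwartzMap ℝ ℂ) {y₀ : ℝ} (hy₀ : y₀ ∈ Set.Ioo 0 a) :
    HasDerivAt (fun y : ℝ ↦ ∫ x : ℝ, g (↑x + ↑y * Complex.I) * f x)
      (-Complex.I * ∫ x : ℝ, g (↑x + ↑y₀ * Complex.I) * deriv f x) y₀ := by
  obtain ⟨r, hr, A, B, hAB⟩ := exists_poly_bound_deriv_of_slow_growth hg hC hbound hy₀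
  have hopen := isOpen_horizontal_strip a
  have hmem : ∀ x y : ℝ, y ∈ Set.Ioo 0 a →
      (↑x + ↑y * Complex.I) ∈ {τ : ℂ | 0 < τ.im ∧ τ.im < a} := by
    intro x y hy
    simpa using hy
  have hgd : ∀ x y : ℝ, y ∈ Set.Ioo 0 a →
      HasDerivAt g (deriv g (↑x + ↑y * Complex.I)) (↑x + ↑y * Complex.I) := fun x y hy ↦
    ((hg _ (hmem x y hy)).differentiableAt (hopen.mem_nhds (hmem x y hy))).hasDerivAt
  have hcont : ∀ y ∈ Set.Ioo 0 a, Continuous fun x : ℝ ↦ g (↑x + ↑y * Complex.I) :=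
    fun y hy ↦ hg.continuousOn.comp_continuous (by fun_prop) fun x ↦ hmem x y hy
  have hcont' : ∀ y ∈ Set.Ioo 0 a, Continuous fun x : ℝ ↦ deriv g (↑x + ↑y * Complex.I) :=
    fun y hy ↦ (hg.deriv hopen).continuousOn.comp_continuous (by fun_prop) fun x ↦ hmem x y hy
  have hint : ∀ φ : SchwartzMap ℝ ℂ, Integrable fun x : ℝ ↦ g (↑x + ↑y₀ * Complex.I) * φ x := by
    intro φ
    refine φ.integrable_mul_of_poly_growth (hcont y₀ hy₀)
      (A := C / y₀ ^ M) (B := C / y₀ ^ M) (N := N) fun x ↦ ?_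
    refine (hbound x y₀ hy₀.1 hy₀.2).trans_eq ?_
    ring
  have hint' : Integrable fun x : ℝ ↦ deriv g (↑x + ↑y₀ * Complex.I) * f x :=
    f.integrable_mul_of_poly_growth (hcont' y₀ hy₀) (hAB y₀ (Metric.mem_ball_self hr)).2
  have hparts : ∫ x : ℝ, g (↑x + ↑y₀ * Complex.I) * deriv f x =
      -∫ x : ℝ, deriv g (↑x + ↑y₀ * Complex.I) * f x := by
    refine integral_mul_deriv_eq_deriv_mul_of_integrable (fun x _ ↦ ?_)
      (fun x _ ↦ f.hasDerivAt x) (hint (SchwartzMap.derivCLM ℂ ℂ f)) hint' (hint f)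
    have h : HasDerivAt (fun t : ℝ ↦ (t : ℂ) + ↑y₀ * Complex.I) 1 x :=
      (ofRealCLM.hasDerivAt (x := x)).add_const _
    simpa [Function.comp_def] using (hgd x y₀ hy₀).comp x h
  have hmain := (hasDerivAt_integral_of_dominated_loc_of_deriv_le (μ := volume)
    (F := fun (y : ℝ) (x : ℝ) ↦ g (↑x + ↑y * Complex.I) * f x)
    (F' := fun (y : ℝ) (x : ℝ) ↦ deriv g (↑x + ↑y * Complex.I) * Complex.I * f x)
    (bound := fun x ↦ (A + B * |x| ^ N) * ‖f x‖)
    (Metric.ball_mem_nhds y₀ hr) ?_ (hint f) ?_ ?_ (f.integrable_poly_mul_norm A B N) ?_).2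
  · rw [hparts, neg_mul_neg, ← integral_const_mul]
    simpa only [mul_assoc, mul_left_comm Complex.I] using hmain
  · filter_upwards [Ioo_mem_nhds hy₀.1 hy₀.2] with y hy
    exact ((hcont y hy).mul f.continuous).aestronglyMeasurable
  · exact (((hcont' y₀ hy₀).mul continuous_const).mul f.continuous).aestronglyMeasurable
  · refine Eventually.of_forall fun x y hy ↦ ?_
    rw [norm_mul, norm_mul, norm_I, mul_one]
    gcongr
    exact (hAB y hy).2 x
  · refine Eventually.of_forall fun x y hy ↦ ?_
    have h : HasDerivAt (fun t : ℝ ↦ (x : ℂ) + ↑t * Complex.I) Complex.I y := by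
      simpa using ((ofRealCLM.hasDerivAt (x := y)).mul_const Complex.I).const_add (x : ℂ)
    exact ((hgd x y (hAB y hy).1).comp y h).mul_const _

/-- The iterated derivatives of a Schwartz function are Schwartz functions. -/
lemma SchwartzMap.exists_coe_eq_iteratedDeriv (f : SchwartzMap ℝ ℂ) (j : ℕ) :
    ∃ φ : SchwartzMap ℝ ℂ, ⇑φ = iteratedDeriv j f := by
  induction j with
  | zero => exact ⟨f, iteratedDeriv_zero.symm⟩
  | succ j ih =>
    obtain ⟨φ, hφ⟩ := ih
    refine ⟨SchwartzMap.derivCLM ℂ ℂ φ, ?_⟩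
    rw [iteratedDeriv_succ, ← hφ]
    rfl

/-- **Derivatives of the smeared function `L(y) = ∫ g(x+iy) f(x) dx`.**
If `g` is holomorphic on the strip `0 < Im τ < a` with a slow-growth bound and `f` is
Schwartz, then `L` is infinitely differentiable on `(0,a)` and
`L^{(j)}(y) = (-i)^j ∫ g(x+iy) f^{(j)}(x) dx`. -/
theorem smeared_function_derivatives
    (a : ℝ) (ha : 0 < a)
    (g : ℂ → ℂ)
    (hg : DifferentiableOn ℂ g {τ : ℂ | 0 < τ.im ∧ τ.im < a})
    (C : ℝ) (hC : 0 < C) (N M : ℕ)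
    (hbound : ∀ x y : ℝ, 0 < y → y < a →
      ‖g (↑x + ↑y * Complex.I)‖ ≤ C * (1 + |x| ^ N) / y ^ M)
    (f : SchwartzMap ℝ ℂ)
    (L : ℝ → ℂ)
    (hL : ∀ y : ℝ, L y = ∫ x : ℝ, g (↑x + ↑y * Complex.I) * f x) :
    ContDiffOn ℝ (⊤ : ℕ∞) L (Set.Ioo 0 a) ∧
    ∀ j : ℕ, ∀ y ∈ Set.Ioo 0 a,
      iteratedDerivWithin j L (Set.Ioo 0 a) y =
        (-Complex.I) ^ j *
          ∫ x : ℝ, g (↑x + ↑y * Complex.I) * iteratedDeriv j (⇑f) x := by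
  have hderiv : ∀ j : ℕ, ∀ y ∈ Set.Ioo 0 a, HasDerivAt
      (fun y : ℝ ↦ (-Complex.I) ^ j * ∫ x : ℝ, g (↑x + ↑y * Complex.I) * iteratedDeriv j (⇑f) x)
      ((-Complex.I) ^ (j + 1) *
        ∫ x : ℝ, g (↑x + ↑y * Complex.I) * iteratedDeriv (j + 1) (⇑f) x) y := by
    intro j y hy
    obtain ⟨φ, hφ⟩ := f.exists_coe_eq_iteratedDeriv j
    rw [iteratedDeriv_succ, ← hφ, pow_succ, mul_assoc]
    exact (hasDerivAt_integral_mul_schwartz hg hC hbound φ hy).const_mul _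
  have hformula : ∀ j : ℕ, Set.EqOn (iteratedDerivWithin j L (Set.Ioo 0 a))
      (fun y : ℝ ↦ (-Complex.I) ^ j *
        ∫ x : ℝ, g (↑x + ↑y * Complex.I) * iteratedDeriv j (⇑f) x) (Set.Ioo 0 a) := by
    intro j
    induction j with
    | zero =>
      intro y _
      simp [hL]
    | succ j ih =>
      intro y hy
      rw [iteratedDerivWithin_succ, derivWithin_congr ih (ih hy)]
      exact (hderiv j y hy).hasDerivWithinAt.derivWithin (isOpen_Ioo.uniqueDiffWithinAt hy)
  refine ⟨contDiffOn_of_differentiableOn_deriv fun j _ ↦ ?_, fun j y hy ↦ hformula j hy⟩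
  exact DifferentiableOn.congr
    (fun y hy ↦ (hderiv j y hy).differentiableAt.differentiableWithinAt) (hformula j)
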